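/- Let K be a totally real number field, let n ≥ 3 be an integer, and let m be a positive integer with m ≤ n + 2. For every finite family L_1, …, L_s of unimodular O_K-lattices of rank m, there exists an O_K-lattice of rank n that is not represented by any of the L_i. -/

import Mathlib

open scoped TensorProduct

noncomputable section

open NumberField

structure OKLattice (K : Type) [Field K] : Type 1 where
  carrier : Type
  [addCommGroup : AddCommGroup carrier]
  [module : Module (𝓞 K) carrier]
  [finite : Module.Finite (𝓞 K) carrier]
  [torsionFree : NoZeroSMulDivisors (𝓞 K) carrier]
  form : carrier →ₗ[𝓞 K] carrier →ₗ[𝓞 K] 𝓞 K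
  symm : ∀ x y, form x y = form y x
  posDef : ∀ v : carrier, v ≠ 0 → ∀ σ : K →+* ℝ, 0 < σ (algebraMap (𝓞 K) K (form v v))

attribute [instance] OKLattice.addCommGroup OKLattice.module OKLattice.finite
  OKLattice.torsionFree

namespace OKLattice

variable {K : Type} [Field K]

/-- The rank of an `O_K`-lattice: the `K`-dimension of `L ⊗ K`. -/
def rank (L : OKLattice K) : ℕ :=
  Module.finrank K (K ⊗[𝓞 K] L.carrier)

/-- `L.Represents L'` : `L'` is represented by `L`. -/
def Represents (L L' : OKLattice K) : Prop :=
  ∃ σ : L'.carrier →ₗ[𝓞 K] L.carrier, ∀ x, L.form (σ x) (σ x) = L'.form x x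

/-- `L` is `n`-universal. -/
def IsUniversal (L : OKLattice K) (n : ℕ) : Prop :=
  ∀ L' : OKLattice K, L'.rank = n → L.Represents L'

/-- `L` is unimodular. -/
def IsUnimodular (L : OKLattice K) : Prop :=
  Function.Bijective ⇑L.form

end OKLattice

/-- `U_K(n)`: the minimal rank of an `n`-universal `O_K`-lattice. -/
def minUnivRank (K : Type) [Field K] (n : ℕ) : ℕ :=
  sInf {m | ∃ L : OKLattice K, L.IsUniversal n ∧ L.rank = m}

/-- `K` is totally real: every embedding into `ℂ` has image contained in `ℝ`. -/
def TotallyReal (K : Type) [Field K] : Prop :=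
  ∀ φ : K →+* ℂ, ∀ x : K, (φ x).im = 0

theorem det_gram_mul_det_gram_eq_sq {F V J : Type*} [Field F] [AddCommGroup V] [Module F V]
    [FiniteDimensional F V] [Fintype J] [DecidableEq J] (hV : Module.finrank F V ≤ Fintype.card J)
    (B : LinearMap.BilinForm F V) (x y : J → V) :
    (Matrix.of fun i j => B (x i) (x j)).det * (Matrix.of fun i j => B (y i) (y j)).det =
      (Matrix.of fun i j => B (x i) (y j)).det ^ 2 := by
  obtain ⟨e, he⟩ : ∃ e : J → V, Submodule.span F (Set.range e) = ⊤ := by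
    let b := Module.finBasis F V
    obtain ⟨g⟩ : Nonempty (Fin (Module.finrank F V) ↪ J) :=
      Function.Embedding.nonempty_of_card_le (by simpa using hV)
    refine ⟨Function.extend g b 0, eq_top_iff.2 ?_⟩
    rw [← b.span_eq]
    refine Submodule.span_mono ?_
    rintro _ ⟨i, rfl⟩
    exact ⟨g i, g.injective.extend_apply _ _ _⟩
  have coord : ∀ z : J → V, ∃ A : Matrix J J F, ∀ i, z i = ∑ k, A i k • e k := fun z => by
    have h : ∀ i, ∃ a : J → F, ∑ k, a k • e k = z i := fun i =>
      (Submodule.mem_span_range_iff_exists_fun F).1 (he ▸ Submodule.mem_top)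
    choose A hA using h
    exact ⟨A, fun i => (hA i).symm⟩
  have gram : ∀ {z z' : J → V} {A A' : Matrix J J F}, (∀ i, z i = ∑ k, A i k • e k) →
      (∀ i, z' i = ∑ k, A' i k • e k) → (Matrix.of fun i j => B (z i) (z' j)).det =
        A.det * (Matrix.of fun i j => B (e i) (e j)).det * A'.det := by
    intro z z' A A' hA hA'
    rw [← Matrix.det_transpose A', ← Matrix.det_mul, ← Matrix.det_mul]
    congr 1
    ext i j
    simp only [Matrix.of_apply, hA, hA', Matrix.mul_apply, map_sum, map_smul, LinearMap.sum_apply,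
      LinearMap.smul_apply, smul_eq_mul, Matrix.transpose_apply, Finset.mul_sum, Finset.sum_mul]
    exact Finset.sum_congr rfl fun k _ => Finset.sum_congr rfl fun l _ => by ring
  obtain ⟨A, hA⟩ := coord x
  obtain ⟨A', hA'⟩ := coord y
  rw [gram hA hA, gram hA' hA', gram hA hA']
  ring

/-- Vectors pairing into an ideal `P` with a whole unimodular lattice lie in `P L`. -/
theorem mem_ideal_smul_top_of_forall_form_mem {R L : Type*} [CommRing R] [AddCommGroup L]
    [Module R L] [Module.Finite R L] [Module.Projective R L] (B : L →ₗ[R] L →ₗ[R] R)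
    (hsurj : Function.Surjective B) {P : Ideal R} {x : L}
    (hx : ∀ t, B t x ∈ P) : x ∈ P • (⊤ : Submodule R L) := by
  obtain ⟨n, f, g, -, -, hfg⟩ := Module.Finite.exists_comp_eq_id_of_projective R L
  choose t ht using fun i : Fin n => hsurj ((LinearMap.proj i).comp g)
  have key : x = ∑ i, B (t i) x • f (fun j => if i = j then 1 else 0) := by
    conv_lhs => rw [show x = f (g x) from (LinearMap.congr_fun hfg x).symm]
    rw [LinearMap.pi_apply_eq_sum_univ f (g x)]
    exact Finset.sum_congr rfl fun i _ => by rw [ht i]; simp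
  rw [key]
  exact Submodule.sum_mem _ fun i _ => Submodule.smul_mem_smul (hx _) Submodule.mem_top

theorem form_mem_sq_of_mem_ideal_smul_top {R L : Type*} [CommRing R] [AddCommGroup L]
    [Module R L] (B : L →ₗ[R] L →ₗ[R] R) {P : Ideal R} {x y : L}
    (hx : x ∈ P • (⊤ : Submodule R L)) (hy : y ∈ P • (⊤ : Submodule R L)) :
    B x y ∈ P ^ 2 := by
  have h1 : ∀ x, ∀ y ∈ P • (⊤ : Submodule R L), B x y ∈ P := by
    intro x y hy
    induction hy using Submodule.smul_induction_on' with
    | smul r hr n hn => simpa using P.mul_mem_right _ hr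
    | add a ha b hb iha ihb => simpa using P.add_mem iha ihb
  induction hx using Submodule.smul_induction_on' with
  | smul r hr n hn =>
    rw [map_smul, LinearMap.smul_apply, smul_eq_mul, sq]
    exact Ideal.mul_mem_mul hr (h1 _ _ hy)
  | add a ha b hb iha ihb => simpa using (P ^ 2).add_mem iha ihb

theorem Ideal.mem_of_mul_mem_sq {R : Type*} [CommRing R] {P : Ideal R} [hP : P.IsMaximal]
    {p t : R} (hp : p ∈ P) (hp2 : p ∉ P ^ 2) (h : p * t ∈ P ^ 2) : t ∈ P := by
  by_contra ht
  obtain ⟨s, q, hq, hs⟩ := hP.exists_inv ht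
  apply hp2
  have : p = s * (p * t) + p * q := by linear_combination -p * hs
  rw [this, sq]
  exact Ideal.add_mem _ (Ideal.mul_mem_left _ _ (sq P ▸ h)) (Ideal.mul_mem_mul hp hq)

/-- A pair of functionals which is independent modulo a maximal ideal has a dual pair. -/
theorem exists_dual_pair_mod {R L : Type*} [CommRing R] [AddCommGroup L] [Module R L]
    {P : Ideal R} [P.IsMaximal] (φ ψ : L →ₗ[R] R)
    (h : ∀ α β : R, (∀ t, α * φ t + β * ψ t ∈ P) → α ∈ P ∧ β ∈ P) :
    ∃ u w : L, φ u - 1 ∈ P ∧ ψ u ∈ P ∧ φ w ∈ P ∧ ψ w - 1 ∈ P := by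
  let f := Ideal.Quotient.mk P
  let := Ideal.Quotient.field P
  have norm : ∀ θ : L →ₗ[R] R, (∃ t, θ t ∉ P) → ∃ t, f (θ t) = 1 := by
    rintro θ ⟨t, ht⟩
    obtain ⟨c, hc⟩ := Ideal.Quotient.mk_surjective (f (θ t))⁻¹
    refine ⟨c • t, ?_⟩
    rw [map_smul, smul_eq_mul, map_mul]
    change Ideal.Quotient.mk P c * _ = 1
    rw [hc]
    exact inv_mul_cancel₀ (by simpa [f, Ideal.Quotient.eq_zero_iff_mem] using ht)
  have h1 : (1 : R) ∉ P := P.ne_top_iff_one.1 (Ideal.IsMaximal.ne_top ‹_›)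
  obtain ⟨t, ht⟩ := norm φ (by
    by_contra! H
    exact h1 (h 1 0 fun t => by simpa using H t).1)
  obtain ⟨s, hs⟩ := norm (ψ - ψ t • φ) (by
    by_contra! H
    exact h1 (h (-ψ t) 1 fun t => by convert H t using 1; simp; ring).2)
  simp only [LinearMap.sub_apply, LinearMap.smul_apply, smul_eq_mul, map_sub, map_mul] at hs
  refine ⟨(1 + ψ t * φ s) • t - ψ t • s, s - φ s • t, ?_, ?_, ?_, ?_⟩ <;>
    rw [← Ideal.Quotient.eq_zero_iff_mem] <;> change f _ = 0 <;>
    simp only [map_sub, map_smul, smul_eq_mul, map_mul, map_add, map_one]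
  · linear_combination (1 + f (ψ t) * f (φ s)) * ht
  · linear_combination -f (ψ t) * hs
  · linear_combination -f (φ s) * ht
  · linear_combination hs

/-- The determinant of an orthogonal family completed by two hyperbolic pairs. -/
theorem det_fromBlocks_diagonal_hyperbolic {F ι : Type*} [CommRing F] [Fintype ι] [DecidableEq ι]
    (c : ι → F) (p q r s : F) :
    (Matrix.fromBlocks (Matrix.diagonal c) 0 0
      !![0, 0, 1, 0; 0, 0, 0, 1; 1, 0, p, q; 0, 1, r, s]).det = ∏ i, c i := by
  rw [Matrix.det_fromBlocks_zero₂₁, Matrix.det_diagonal]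
  simp [Matrix.det_succ_row_zero, Fin.sum_univ_succ, Fin.succAbove]

theorem exists_isSquare_discriminant_mul_det {K : Type} [Field K] [NumberField K] (L : OKLattice K)
    (P : Ideal (𝓞 K)) [P.IsMaximal] {J : Type*} [Fintype J] [DecidableEq J]
    (hJ : L.rank ≤ Fintype.card J) :
    ∃ d : 𝓞 K ⧸ P, d ≠ 0 ∧ ∀ z : J → L.carrier, IsSquare
      (d * Ideal.Quotient.mk P (Matrix.of fun i j => L.form (z i) (z j)).det) := by
  by_cases h : ∃ y : J → L.carrier,
      Ideal.Quotient.mk P (Matrix.of fun i j => L.form (y i) (y j)).det ≠ 0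
  · obtain ⟨y, hy⟩ := h
    refine ⟨_, hy, fun z => ?_⟩
    have key : (Matrix.of fun i j => L.form (y i) (y j)).det *
        (Matrix.of fun i j => L.form (z i) (z j)).det =
          (Matrix.of fun i j => L.form (y i) (z j)).det ^ 2 := by
      apply FaithfulSMul.algebraMap_injective (𝓞 K) K
      have map_gram : ∀ z z' : J → L.carrier,
          algebraMap (𝓞 K) K (Matrix.of fun i j => L.form (z i) (z' j)).det =
            (Matrix.of fun i j => LinearMap.BilinForm.baseChange K L.form
              ((1 : K) ⊗ₜ[𝓞 K] z i) ((1 : K) ⊗ₜ[𝓞 K] z' j)).det := by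
        intro z z'
        rw [RingHom.map_det]
        congr 1
        ext i j
        simp [Algebra.smul_def]
      rw [map_mul, map_pow, map_gram, map_gram, map_gram]
      exact det_gram_mul_det_gram_eq_sq hJ _ _ _
    rw [← map_mul, key, map_pow]
    exact IsSquare.sq _
  · push Not at h
    exact ⟨1, one_ne_zero, fun z => by rw [h z]; simp⟩

theorem OKLattice.projective_carrier {K : Type} [Field K] [NumberField K] (L : OKLattice K) :
    Module.Projective (𝓞 K) L.carrier :=
  have : Module.FinitePresentation (𝓞 K) L.carrier := Module.finitePresentation_of_finite _ _
  Module.Flat.projective_of_finitePresentation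

/-- The local obstruction at `P` to a unimodular lattice containing an orthogonal family with
norms `c i`, `p` and `b p`, where `p` has valuation one at `P`. -/
theorem false_of_orthogonal_family {R L : Type*} [CommRing R] [AddCommGroup L] [Module R L]
    [Module.Finite R L] [Module.Projective R L] (B : L →ₗ[R] L →ₗ[R] R)
    (hB : ∀ x y, B x y = B y x) (hsurj : Function.Surjective B) {P : Ideal R} [P.IsMaximal]
    {ι : Type*} [Fintype ι] [DecidableEq ι] {e : ι → L} {u w : L} {c : ι → R} {p b : R}
    {d : R ⧸ P} (hp : p ∈ P) (hp2 : p ∉ P ^ 2) (hb : ¬ IsSquare (-Ideal.Quotient.mk P b))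
    (hc : ¬ IsSquare (d * Ideal.Quotient.mk P (∏ i, c i)))
    (hd : ∀ z : ι ⊕ Fin 4 → L, IsSquare
      (d * Ideal.Quotient.mk P (Matrix.of fun i j => B (z i) (z j)).det))
    (hee : ∀ i j, B (e i) (e j) = Matrix.diagonal c i j) (heu : ∀ i, B (e i) u = 0)
    (hew : ∀ i, B (e i) w = 0) (huu : B u u = p) (hww : B w w = b * p) (huw : B u w = 0) :
    False := by
  let := Ideal.Quotient.field P
  let f := Ideal.Quotient.mk P
  have hf : ∀ {x}, f x = 0 ↔ x ∈ P := Ideal.Quotient.eq_zero_iff_mem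
  have hwu : B w u = 0 := by rw [hB, huw]
  have hue : ∀ i, B u (e i) = 0 := fun i => by rw [hB, heu]
  have hwe : ∀ i, B w (e i) = 0 := fun i => by rw [hB, hew]
  have indep : ∀ α β : R, (∀ t, α * B u t + β * B w t ∈ P) → α ∈ P ∧ β ∈ P := by
    intro α β h
    have hmem : α • u + β • w ∈ P • (⊤ : Submodule R L) :=
      mem_ideal_smul_top_of_forall_form_mem B hsurj fun t => by
        rw [hB]; simpa using h t
    have hsq := form_mem_sq_of_mem_ideal_smul_top B hmem hmem
    have hval : B (α • u + β • w) (α • u + β • w) = p * (α ^ 2 + b * β ^ 2) := by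
      simp only [map_add, map_smul, LinearMap.add_apply, LinearMap.smul_apply, smul_eq_mul, huu,
        hww, huw, hwu]
      ring
    rw [hval] at hsq
    have h0 := hf.2 (Ideal.mem_of_mul_mem_sq hp hp2 hsq)
    simp only [map_add, map_mul, map_pow] at h0
    have hβ : f β = 0 := by
      by_contra hβ
      refine hb ⟨f α / f β, ?_⟩
      change -f b = _
      field_simp
      linear_combination -h0
    refine ⟨hf.1 ?_, hf.1 hβ⟩
    simpa [hβ] using h0
  have hcinv : ∀ i, ∃ r : R, f (c i) * f r = 1 := by
    intro i
    have hci : f (c i) ≠ 0 := fun h0 => hc (by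
      rw [map_prod, Finset.prod_eq_zero (Finset.mem_univ i) h0, mul_zero]
      exact IsSquare.zero)
    obtain ⟨r, hr⟩ := Ideal.Quotient.mk_surjective (f (c i))⁻¹
    exact ⟨r, by rw [show f r = (f (c i))⁻¹ from hr, mul_inv_cancel₀ hci]⟩
  choose r hr using hcinv
  obtain ⟨u₀, w₀, h1, h2, h3, h4⟩ := exists_dual_pair_mod (B u) (B w) indep
  let proj : L → L := fun t => t - ∑ i, (r i * B (e i) t) • e i
  have proj_e : ∀ t i, f (B (e i) (proj t)) = 0 := by
    intro t i
    simp only [proj, map_sub, map_sum, map_smul, smul_eq_mul, hee, Matrix.diagonal_apply,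
      mul_ite, mul_zero, Finset.sum_ite_eq, Finset.mem_univ, if_true, map_mul]
    linear_combination -f (B (e i) t) * hr i
  have proj_u : ∀ t, B u (proj t) = B u t := fun t => by simp [proj, hue]
  have proj_w : ∀ t, B w (proj t) = B w t := fun t => by simp [proj, hwe]
  rw [← hf, map_sub, map_one, sub_eq_zero, ← proj_u] at h1
  rw [← hf, ← proj_w] at h2
  rw [← hf, ← proj_u] at h3
  rw [← hf, map_sub, map_one, sub_eq_zero, ← proj_w] at h4
  set u' := proj u₀
  set w' := proj w₀
  have hfp : f p = 0 := hf.2 hp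
  let z : ι ⊕ Fin 4 → L := Sum.elim e ![u, w, u', w']
  have hgram : f (Matrix.of fun i j => B (z i) (z j)).det = f (∏ i, c i) := by
    rw [RingHom.map_det, map_prod, ← det_fromBlocks_diagonal_hyperbolic (fun i => f (c i))
      (f (B u' u')) (f (B u' w')) (f (B w' u')) (f (B w' w'))]
    congr 1
    ext (i | i) (j | j)
    · simp [z, hee, Matrix.diagonal_apply, apply_ite f]
    · fin_cases j <;> simp [z, heu, hew, u', w', proj_e]
    · fin_cases i <;> simp [z, hue, hwe, hB _ (e j), u', w', proj_e]
    · fin_cases i <;> fin_cases j <;>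
        simp [z, huu, hww, huw, hwu, hfp, h1, h2, h3, h4, hB u' u, hB u' w, hB w' u, hB w' w]
  have := hd z
  rw [show Ideal.Quotient.mk P _ = _ from hgram] at this
  exact hc this

/-- The free lattice with an orthogonal basis of prescribed totally positive norms. -/
def OKLattice.diagonal {K : Type} [Field K] {J : Type} [Fintype J] (c : J → 𝓞 K)
    (hc : ∀ j, ∀ σ : K →+* ℝ, 0 < σ (algebraMap (𝓞 K) K (c j))) : OKLattice K where
  carrier := J → 𝓞 K
  torsionFree := ⟨fun {_ _} h => smul_eq_zero.1 h⟩
  form := LinearMap.mk₂ (𝓞 K) (fun x y => ∑ j, c j * (x j * y j))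
    (fun x y z => by simp [add_mul, mul_add, Finset.sum_add_distrib])
    (fun r x y => by
      simp only [Pi.smul_apply, smul_eq_mul, Finset.mul_sum]
      exact Finset.sum_congr rfl fun _ _ => by ring)
    (fun x y z => by simp [mul_add, Finset.sum_add_distrib])
    (fun r x y => by
      simp only [Pi.smul_apply, smul_eq_mul, Finset.mul_sum]
      exact Finset.sum_congr rfl fun _ _ => by ring)
  symm x y := by simp [mul_comm]
  posDef v hv σ := by
    obtain ⟨j, hj⟩ := Function.ne_iff.1 hv
    simp only [LinearMap.mk₂_apply, map_sum, map_mul]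
    refine Finset.sum_pos' (fun i _ => mul_nonneg (hc i σ).le (mul_self_nonneg _))
      ⟨j, Finset.mem_univ _, mul_pos (hc j σ) (mul_self_pos.2 ?_)⟩
    simpa using hj

theorem OKLattice.rank_diagonal {K : Type} [Field K] [NumberField K] {J : Type} [Fintype J]
    (c : J → 𝓞 K) (hc : ∀ j, ∀ σ : K →+* ℝ, 0 < σ (algebraMap (𝓞 K) K (c j))) :
    (OKLattice.diagonal c hc).rank = Fintype.card J := by
  change Module.finrank K (K ⊗[𝓞 K] (J → 𝓞 K)) = _
  rw [Module.finrank_baseChange, Module.finrank_fintype_fun_eq_card]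

theorem OKLattice.diagonal_form_single {K : Type} [Field K] {J : Type} [Fintype J] [DecidableEq J]
    (c : J → 𝓞 K) (hc : ∀ j, ∀ σ : K →+* ℝ, 0 < σ (algebraMap (𝓞 K) K (c j))) (i j : J) :
    (OKLattice.diagonal c hc).form (Pi.single i 1 : J → 𝓞 K) (Pi.single j 1 : J → 𝓞 K) =
      Matrix.diagonal c i j := by
  change ∑ k, c k * ((Pi.single i 1 : J → 𝓞 K) k * (Pi.single j 1 : J → 𝓞 K) k) = _
  rcases eq_or_ne i j with rfl | h
  · simp [Pi.single_apply]
  · simp [Pi.single_apply, h, h.symm]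

theorem OKLattice.Represents.exists_form_eq {K : Type} [Field K] [NumberField K]
    {L M : OKLattice K} (h : L.Represents M) :
    ∃ τ : M.carrier →ₗ[𝓞 K] L.carrier, ∀ x y, L.form (τ x) (τ y) = M.form x y := by
  obtain ⟨τ, hτ⟩ := h
  refine ⟨τ, fun x y => ?_⟩
  have h := hτ (x + y)
  simp only [map_add, LinearMap.add_apply, hτ, L.symm (τ y) (τ x), M.symm y x] at h
  exact mul_left_cancel₀ (two_ne_zero (α := 𝓞 K)) (by linear_combination h)

theorem exists_pairwise_coprime_maximal (K : Type) [Field K] [NumberField K] (s : ℕ) :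
    ∃ (q : Fin s → ℕ) (P : Fin s → Ideal (𝓞 K)), (∀ i, (P i).IsMaximal) ∧ (∀ i, q i ≠ 0) ∧
      (∀ i, (q i : 𝓞 K) ∈ P i) ∧ (∀ i, (2 : 𝓞 K) ∉ P i) ∧
      Pairwise (Function.onFun IsCoprime P) := by
  let q : Fin s → ℕ := fun i => Nat.nth Nat.Prime (i + 1)
  have hq : ∀ i, (q i).Prime := fun i => Nat.prime_nth_prime _
  have hinj : Function.Injective q := fun i j h => by
    have := Nat.nth_injective Nat.infinite_setOfPred_prime h
    exact Fin.ext (by simpa using this)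
  have h2 : ∀ i, q i ≠ 2 := fun i h => by
    have := Nat.nth_injective Nat.infinite_setOfPred_prime (h.trans Nat.nth_prime_zero_eq_two.symm)
    simp at this
  have hP : ∀ i, ∃ P : Ideal (𝓞 K), P.IsMaximal ∧ (q i : 𝓞 K) ∈ P := fun i => by
    have : (Ideal.span {(q i : ℤ)}).IsMaximal :=
      PrincipalIdealRing.isMaximal_of_irreducible (Nat.prime_iff_prime_int.1 (hq i)).irreducible
    obtain ⟨P, hP, hover⟩ := Ideal.exists_maximal_ideal_liesOver_of_isIntegral (S := 𝓞 K)
      (Ideal.span {(q i : ℤ)})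
    refine ⟨P, hP, ?_⟩
    have := (Ideal.mem_of_liesOver P (Ideal.span {(q i : ℤ)}) (q i)).1
      (Ideal.mem_span_singleton_self _)
    simpa using this
  choose P hmax hmem using hP
  have coprime : ∀ i (r : ℕ), (q i).Coprime r → (r : 𝓞 K) ∉ P i := fun i r h hr => by
    obtain ⟨x, y, hxy⟩ := Nat.isCoprime_iff_coprime.2 h
    refine (P i).ne_top_iff_one.1 (hmax i).ne_top ?_
    have := congrArg (Int.cast : ℤ → 𝓞 K) hxy
    push_cast at this
    rw [← this]
    exact Ideal.add_mem _ (Ideal.mul_mem_left _ _ (hmem i)) (Ideal.mul_mem_left _ _ hr)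
  refine ⟨q, P, hmax, fun i => (hq i).ne_zero, hmem, fun i => ?_, fun i j hij => ?_⟩
  · exact_mod_cast coprime i 2 ((Nat.coprime_primes (hq i) Nat.prime_two).2 (h2 i))
  · refine Ideal.isCoprime_iff_sup_eq.2 ((hmax i).coprime_of_ne (hmax j) fun h => ?_)
    exact coprime i (q j) ((Nat.coprime_primes (hq i) (hq j)).2 (hinj.ne hij)) (h ▸ hmem j)

theorem exists_totallyPositive_sub_mem {K : Type} [Field K] [NumberField K] {ι : Type*}
    [Fintype ι] {I : ι → Ideal (𝓞 K)} (hI : Pairwise (Function.onFun IsCoprime I)) {q : ι → ℕ}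
    (hq : ∀ i, q i ≠ 0) (hqI : ∀ i, (q i : 𝓞 K) ∈ I i) (x : ι → 𝓞 K) :
    ∃ y : 𝓞 K, (∀ i, y - x i ∈ I i) ∧ ∀ σ : K →+* ℝ, 0 < σ (algebraMap (𝓞 K) K y) := by
  obtain ⟨y, hy⟩ := Ideal.exists_forall_sub_mem_ideal hI x
  obtain ⟨k, hk⟩ : ∃ k : ℕ, ∀ σ : K →+* ℝ, -σ (algebraMap (𝓞 K) K y) < k := by
    obtain ⟨C, hC⟩ := (Set.finite_range fun σ : K →+* ℝ => -σ (algebraMap (𝓞 K) K y)).bddAbove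
    obtain ⟨k, hk⟩ := exists_nat_gt C
    exact ⟨k, fun σ => (hC ⟨σ, rfl⟩).trans_lt hk⟩
  let N := ∏ i, q i
  have hN : 1 ≤ N := Nat.one_le_iff_ne_zero.2 (Finset.prod_ne_zero_iff.2 fun i _ => hq i)
  refine ⟨y + k * N, fun i => ?_, fun σ => ?_⟩
  · have : (N : 𝓞 K) ∈ I i := by
      obtain ⟨r, hr⟩ := Finset.dvd_prod_of_mem q (Finset.mem_univ i)
      rw [show N = _ from hr]
      push_cast
      exact Ideal.mul_mem_right _ _ (hqI i)
    rw [add_sub_right_comm]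
    exact Ideal.add_mem _ (hy i) (Ideal.mul_mem_left _ _ this)
  · have h1 : (k : ℝ) ≤ k * N := le_mul_of_one_le_right (by positivity) (by exact_mod_cast hN)
    have h2 := hk σ
    simp only [map_add, map_mul, map_natCast]
    linarith

theorem stmt9 (K : Type) [Field K] [NumberField K] (htr : TotallyReal K)
    (n m : ℕ) (hn : 3 ≤ n) (hm : 1 ≤ m) (hmn : m ≤ n + 2)
    (s : ℕ) (Ls : Fin s → OKLattice K) (hrank : ∀ i, (Ls i).rank = m)
    (huni : ∀ i, (Ls i).IsUnimodular) :
    ∃ M : OKLattice K, M.rank = n ∧ ∀ i, ¬ (Ls i).Represents M := by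
  obtain ⟨k, rfl⟩ : ∃ k, n = k + 3 := ⟨n - 3, by omega⟩
  obtain ⟨q, P, hmax, hq, hqP, h2P, hcop⟩ := exists_pairwise_coprime_maximal K s
  have disc := fun i => exists_isSquare_discriminant_mul_det (Ls i) (P i) (J := Fin (k + 1) ⊕ Fin 4)
    (by rw [hrank i]; simpa using hmn)
  choose d hd0 hd using disc
  have residues : ∀ i, ∃ a b p : 𝓞 K, ¬ IsSquare (d i * Ideal.Quotient.mk (P i) a) ∧
      ¬ IsSquare (-Ideal.Quotient.mk (P i) b) ∧ p ∈ P i ∧ p ∉ P i ^ 2 := fun i => by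
    let := Ideal.Quotient.field (P i)
    have hbot : P i ≠ ⊥ := ((P i).bot_lt_of_maximal (RingOfIntegers.not_isField K)).ne'
    have : Finite (𝓞 K ⧸ P i) := (P i).finiteQuotientOfFreeOfNeBot hbot
    have hchar : ringChar (𝓞 K ⧸ P i) ≠ 2 := fun h => h2P i <| by
      have := ringChar.Nat.cast_ringChar (R := 𝓞 K ⧸ P i)
      rw [h] at this
      rw [← Ideal.Quotient.eq_zero_iff_mem, map_ofNat]
      simpa using this
    obtain ⟨ε, hε⟩ := FiniteField.exists_nonsquare hchar
    obtain ⟨a, ha⟩ := Ideal.Quotient.mk_surjective ((d i)⁻¹ * ε)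
    obtain ⟨b, hb⟩ := Ideal.Quotient.mk_surjective (-ε)
    obtain ⟨p, hp, hp2⟩ := SetLike.exists_of_lt
      ((P i).pow_lt_self hbot (hmax i).ne_top 2 le_rfl)
    refine ⟨a, b, p, ?_, ?_, hp, hp2⟩
    · rwa [ha, mul_inv_cancel_left₀ (hd0 i)]
    · rwa [hb, neg_neg]
  choose a' b' p' ha' hb' hp' hp2' using residues
  have hcop2 : Pairwise (Function.onFun IsCoprime fun i => P i ^ 2) := fun i j hij =>
    (hcop hij).pow
  have lift := exists_totallyPositive_sub_mem hcop2 (q := fun i => q i ^ 2)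
    (fun i => pow_ne_zero _ (hq i))
    (fun i => by push_cast; exact Ideal.pow_mem_pow (hqP i) 2)
  obtain ⟨a, ha, hapos⟩ := lift a'
  obtain ⟨b, hb, hbpos⟩ := lift b'
  obtain ⟨p, hp, hppos⟩ := lift p'
  have mk_eq : ∀ {x y : 𝓞 K} {i}, x - y ∈ P i ^ 2 →
      Ideal.Quotient.mk (P i) x = Ideal.Quotient.mk (P i) y := fun h =>
    Ideal.Quotient.eq.2 (Ideal.pow_le_self two_ne_zero h)
  let c : Fin (k + 1) → 𝓞 K := Fin.cons a fun _ => 1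
  let C : Fin (k + 1) ⊕ Fin 2 → 𝓞 K := Sum.elim c ![p, b * p]
  have hC : ∀ j, ∀ σ : K →+* ℝ, 0 < σ (algebraMap (𝓞 K) K (C j)) := by
    rintro (j | j) σ
    · refine Fin.cases ?_ (fun j => ?_) j
      · simpa [C, c] using hapos σ
      · simp [C, c]
    · fin_cases j
      · simpa [C] using hppos σ
      · simpa [C] using mul_pos (hbpos σ) (hppos σ)
  refine ⟨OKLattice.diagonal C hC, by simp [OKLattice.rank_diagonal], fun i hrep => ?_⟩
  obtain ⟨τ, hτ⟩ := hrep.exists_form_eq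
  have := (Ls i).projective_carrier
  let v : Fin (k + 1) ⊕ Fin 2 → (Ls i).carrier := fun j =>
    τ (Pi.single j 1 : Fin (k + 1) ⊕ Fin 2 → 𝓞 K)
  have hv : ∀ j l, (Ls i).form (v j) (v l) = Matrix.diagonal C j l := fun j l =>
    (hτ _ _).trans (OKLattice.diagonal_form_single C hC j l)
  refine false_of_orthogonal_family (Ls i).form (Ls i).symm (huni i).2 (P := P i)
    (e := fun j => v (Sum.inl j)) (u := v (Sum.inr 0)) (w := v (Sum.inr 1)) (c := c) (p := p)
    (b := b) (d := d i) ?_ ?_ ?_ ?_ (hd i) ?_ ?_ ?_ ?_ ?_ ?_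
  · rw [← Ideal.Quotient.eq_zero_iff_mem, mk_eq (hp i), Ideal.Quotient.eq_zero_iff_mem]
    exact hp' i
  · exact fun h => hp2' i (by simpa using (P i ^ 2).sub_mem h (hp i))
  · rw [mk_eq (hb i)]
    exact hb' i
  · rw [show ∏ j, c j = a by simp [c, Fin.prod_univ_succ], mk_eq (ha i)]
    exact ha' i
  all_goals simp [hv, C, Matrix.diagonal_apply]
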